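/- Let (x*, y*, λ*) be a saddle-point datum with optimal value F*, and let g be μ_g-strongly convex. Fix k ≥ 1, τ_k ∈ (0,1], ρ_{k−1} > 0, ρ_k > 0, γ₀ ≥ 0. Let (x^k, y^k), x̃^k, ỹ^k be given, set x̂^k := (1−τ_k)x^k + τ_k x̃^k, ŷ^k := (1−τ_k)y^k + τ_k ỹ^k, and x̃^{k+1} := x̃^k + (1/τ_k)(x^{k+1} − x̂^k), where: there is a subgradient ξ of f at x^{k+1} with ξ + ρ_k A* ŝ + γ₀ (x^{k+1} − x̂^k) = 0; there is η with η + ρ_k B* ŝ + τ_k ρ_k ‖B‖² (ỹ^{k+1} − ỹ^k) = 0 and g(y) ≥ g(ỹ^{k+1}) + ⟨η, y − ỹ^{k+1}⟩ + (μ_g/2)‖y − ỹ^{k+1}‖² for all y; and y^{k+1} := (1−τ_k)y^k + τ_k ỹ^{k+1}; here ŝ := (A x^{k+1} + B ŷ^k − c) − P_K(A x^{k+1} + B ŷ^k − c). Then, with s^k := (A x^k + B y^k − c) − P_K(A x^k + B y^k − c): Φ_{ρ_k}(x^{k+1}, y^{k+1}) ≤ (1−τ_k) Φ_{ρ_{k−1}}(x^k,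 y^k) + τ_k F* + (γ₀ τ_k²/2)‖x̃^k − x*‖² − (γ₀ τ_k²/2)‖x̃^{k+1} − x*‖² + (ρ_k τ_k² ‖B‖²/2)‖ỹ^k − y*‖² − ((ρ_k τ_k² ‖B‖² + μ_g τ_k)/2)‖ỹ^{k+1} − y*‖² − ((1−τ_k)/2)[ρ_{k−1} − ρ_k(1−τ_k)]‖s^k‖². -/

import Mathlib

open scoped RealInnerProductSpace

/-- Three-point identity with the middle term on the left. -/
theorem inner_sub_sub_eq_half_norm_sq {E : Type*} [NormedAddCommGroup E] [InnerProductSpace ℝ E]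
    (a b z : E) :
    ⟪b - a, z - b⟫ = 1 / 2 * (‖a - z‖ ^ 2 - ‖b - a‖ ^ 2 - ‖b - z‖ ^ 2) := by
  have h := norm_add_sq_real (b - a) (z - b)
  rw [sub_add_sub_cancel', norm_sub_rev z a, norm_sub_rev z b] at h
  linarith

/-- A point of `K` satisfying the variational inequality for `u` realizes the distance to `K`. -/
theorem infDist_eq_norm_sub_of_inner_nonpos {E : Type*} [NormedAddCommGroup E]
    [InnerProductSpace ℝ E] {K : Set E} {u p : E} (hp : p ∈ K)
    (h : ∀ w ∈ K, ⟪u - p, w - p⟫ ≤ 0) : Metric.infDist u K = ‖u - p‖ := by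
  refine le_antisymm ((Metric.infDist_le_dist_of_mem hp).trans_eq (dist_eq_norm u p)) ?_
  refine (Metric.le_infDist ⟨p, hp⟩).2 fun w hw => ?_
  rw [dist_eq_norm]
  refine le_of_sq_le_sq ?_ (norm_nonneg _)
  have h1 := norm_sub_sq_real (u - p) (w - p)
  rw [sub_sub_sub_cancel_right] at h1
  linarith [h w hw, sq_nonneg ‖w - p‖]

/-- Adding back the quadratic: `g` is convex when `g - (μ / 2) ‖·‖²` is and `0 ≤ μ`. -/
theorem ConvexOn.of_sub_half_mul_norm_sq {E : Type*} [NormedAddCommGroup E]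
    [InnerProductSpace ℝ E] {g : E → ℝ} {μ : ℝ} (hμ : 0 ≤ μ)
    (hg : ConvexOn ℝ Set.univ fun z => g z - μ / 2 * ‖z‖ ^ 2) : ConvexOn ℝ Set.univ g :=
  (strongConvexOn_iff_convex.2 hg).convexOn fun r => by positivity

/-- If `p`, `q` are the projections of `u`, `a` onto `K` and `b ∈ K`, the first-order
expansion of `(1 / 2) ‖· - p‖²` at `u` towards `(1 - τ) a + τ b` is at most
`((1 - τ)² / 2) ‖a - q‖²`. -/
theorem half_norm_sq_add_inner_le {E : Type*} [NormedAddCommGroup E]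
    [InnerProductSpace ℝ E] {K : Set E} {u p a q b : E} {τ : ℝ} (hτ0 : 0 ≤ τ) (hτ1 : τ ≤ 1)
    (hp : ∀ w ∈ K, ⟪u - p, w - p⟫ ≤ 0) (hq : q ∈ K) (hb : b ∈ K) :
    1 / 2 * ‖u - p‖ ^ 2 + ⟪u - p, (1 - τ) • a + τ • b - u⟫
      ≤ (1 - τ) ^ 2 / 2 * ‖a - q‖ ^ 2 := by
  have h1 : (1 - τ) • a + τ • b - u
      = (1 - τ) • (a - q) + (1 - τ) • (q - p) + τ • (b - p) - (u - p) := by module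
  have h2 := norm_sub_sq_real (u - p) ((1 - τ) • (a - q))
  rw [inner_smul_right, norm_smul, mul_pow, Real.norm_eq_abs, sq_abs] at h2
  rw [h1]
  simp only [inner_sub_right (u - p) _ (u - p), inner_add_right, inner_smul_right,
    real_inner_self_eq_norm_sq]
  linarith [mul_nonpos_of_nonneg_of_nonpos (sub_nonneg.2 hτ1) (hp q hq),
    mul_nonpos_of_nonneg_of_nonpos hτ0 (hp b hb),
    sq_nonneg ‖u - p - (1 - τ) • (a - q)‖]

/-- (Lemma 4: key one-iteration estimate of Algorithm 2 under
`μ_g`-strong convexity of `g`.) For a saddle-point datum `(x⋆,y⋆,λ⋆)` and one step of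
Algorithm 2 (Option 1), one has
`Φ_{ρ_k}(zᵏ⁺¹) ≤ (1−τ_k)Φ_{ρ_{k−1}}(zᵏ) + τ_k F⋆
  + (γ₀τ_k²/2)(‖x̃ᵏ−x⋆‖² − ‖x̃ᵏ⁺¹−x⋆‖²) + (ρ_kτ_k²‖B‖²/2)‖ỹᵏ−y⋆‖²
  − ((ρ_kτ_k²‖B‖² + μ_gτ_k)/2)‖ỹᵏ⁺¹−y⋆‖²
  − ((1−τ_k)/2)[ρ_{k−1} − ρ_k(1−τ_k)]‖sᵏ‖²`. -/
theorem stmt_12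
    {H1 H2 H : Type*}
    [NormedAddCommGroup H1] [InnerProductSpace ℝ H1] [CompleteSpace H1]
    [NormedAddCommGroup H2] [InnerProductSpace ℝ H2] [CompleteSpace H2]
    [NormedAddCommGroup H] [InnerProductSpace ℝ H] [CompleteSpace H]
    (A : H1 →L[ℝ] H) (B : H2 →L[ℝ] H) (c : H) (K : Set H)
    (hKne : K.Nonempty) (hKcl : IsClosed K) (hKcv : Convex ℝ K)
    (P : H → H) (hPmem : ∀ u, P u ∈ K)
    (hPproj : ∀ u, ∀ w ∈ K, ⟪u - P u, w - P u⟫ ≤ 0)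
    (f : H1 → ℝ) (g : H2 → ℝ)
    (hf : ConvexOn ℝ Set.univ f)
    (μ : ℝ) (hμ : 0 < μ)
    (hg : ConvexOn ℝ Set.univ (fun z : H2 => g z - μ/2 * ‖z‖ ^ 2))
    (xs : H1) (ys : H2) (lams : H)
    (hfeas : A xs + B ys - c ∈ K)
    (hsaddle : ∀ (x : H1) (y : H2), ∀ r ∈ K,
      f x + g y - ⟪lams, A x + B y - r - c⟫ ≥ f xs + g ys)
    (k : ℕ) (hk : 1 ≤ k) (τ : ℝ) (hτ0 : 0 < τ) (hτ1 : τ ≤ 1)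
    (ρkm ρk γ0 : ℝ) (hρkm : 0 < ρkm) (hρk : 0 < ρk) (hγ0 : 0 ≤ γ0)
    (xk xtk xtk1 xhk xk1 : H1) (yk ytk ytk1 yhk yk1 : H2)
    (hxh : xhk = (1 - τ) • xk + τ • xtk)
    (hyh : yhk = (1 - τ) • yk + τ • ytk)
    (hxt1 : xtk1 = xtk + (1/τ) • (xk1 - xhk))
    (ξ : H1) (hξ : ∀ x : H1, f x ≥ f xk1 + ⟪ξ, x - xk1⟫)
    (hξ0 : ξ + ρk • (ContinuousLinearMap.adjoint A
          ((A xk1 + B yhk - c) - P (A xk1 + B yhk - c)))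
        + γ0 • (xk1 - xhk) = 0)
    (η : H2)
    (hη0 : η + ρk • (ContinuousLinearMap.adjoint B
          ((A xk1 + B yhk - c) - P (A xk1 + B yhk - c)))
        + (τ * ρk * ‖B‖ ^ 2) • (ytk1 - ytk) = 0)
    (hη : ∀ y : H2, g y ≥ g ytk1 + ⟪η, y - ytk1⟫ + (μ/2) * ‖y - ytk1‖ ^ 2)
    (hyk1 : yk1 = (1 - τ) • yk + τ • ytk1) :
    f xk1 + g yk1 + ρk * ((1/2) * Metric.infDist (A xk1 + B yk1 - c) K ^ 2) ≤
      (1 - τ) * (f xk + g yk + ρkm * ((1/2) * Metric.infDist (A xk + B yk - c) K ^ 2))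
        + τ * (f xs + g ys)
        + (γ0 * τ ^ 2 / 2) * ‖xtk - xs‖ ^ 2
        - (γ0 * τ ^ 2 / 2) * ‖xtk1 - xs‖ ^ 2
        + (ρk * τ ^ 2 * ‖B‖ ^ 2 / 2) * ‖ytk - ys‖ ^ 2
        - ((ρk * τ ^ 2 * ‖B‖ ^ 2 + μ * τ) / 2) * ‖ytk1 - ys‖ ^ 2
        - ((1 - τ) / 2) * (ρkm - ρk * (1 - τ))
            * ‖(A xk + B yk - c) - P (A xk + B yk - c)‖ ^ 2 := by
  have hgc := hg.of_sub_half_mul_norm_sq hμ.le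
  rw [infDist_eq_norm_sub_of_inner_nonpos (hPmem (A xk + B yk - c)) (hPproj _)]
  have hkey := half_norm_sq_add_inner_le (a := A xk + B yk - c) hτ0.le hτ1
    (hPproj (A xk1 + B yhk - c)) (hPmem (A xk + B yk - c)) hfeas
  have hdist : Metric.infDist (A xk1 + B yk1 - c) K ^ 2
      ≤ ‖A xk1 + B yk1 - c - P (A xk1 + B yhk - c)‖ ^ 2 :=
    pow_le_pow_left₀ Metric.infDist_nonneg
      ((Metric.infDist_le_dist_of_mem (hPmem _)).trans_eq (dist_eq_norm _ _)) 2
  have hv : A xk1 + B yk1 - c - P (A xk1 + B yhk - c)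
      = (A xk1 + B yhk - c - P (A xk1 + B yhk - c)) + τ • B (ytk1 - ytk) := by
    rw [hyk1, hyh]
    simp only [map_add, map_sub, map_smul]
    module
  have hdir : (1 - τ) • (A xk + B yk - c) + τ • (A xs + B ys - c) - (A xk1 + B yhk - c)
      = A ((1 - τ) • xk + τ • xs - xk1) + τ • B (ys - ytk1) + τ • B (ytk1 - ytk) := by
    rw [hyh]
    simp only [map_add, map_sub, map_smul]
    module
  rw [hv, norm_add_sq_real, inner_smul_right, norm_smul, mul_pow, Real.norm_eq_abs,
    sq_abs] at hdist
  rw [hdir, inner_add_right, inner_add_right, inner_smul_right, inner_smul_right] at hkey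
  set s := A xk1 + B yhk - c - P (A xk1 + B yhk - c)
  have hB : ‖B (ytk1 - ytk)‖ ^ 2 ≤ ‖B‖ ^ 2 * ‖ytk1 - ytk‖ ^ 2 := by
    rw [← mul_pow]
    exact pow_le_pow_left₀ (norm_nonneg _) (B.le_opNorm _) 2
  have hx_step : xk1 - xhk = τ • (xtk1 - xtk) := by
    rw [hxt1, add_sub_cancel_left, smul_smul, mul_one_div_cancel hτ0.ne', one_smul]
  have hx_dir : (1 - τ) • xk + τ • xs - xk1 = τ • (xs - xtk1) := by
    rw [← sub_add_cancel xk1 xhk, hx_step, hxh]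
    module
  have hξ_inner : ⟪ξ, (1 - τ) • xk + τ • xs - xk1⟫
      = -(ρk * ⟪s, A ((1 - τ) • xk + τ • xs - xk1)⟫)
        - γ0 * τ ^ 2 * ⟪xtk1 - xtk, xs - xtk1⟫ := by
    have h := congrArg (fun z => ⟪z, (1 - τ) • xk + τ • xs - xk1⟫) hξ0
    simp only [inner_add_left, real_inner_smul_left, ContinuousLinearMap.adjoint_inner_left,
      inner_zero_left] at h
    have h' : ⟪xk1 - xhk, (1 - τ) • xk + τ • xs - xk1⟫
        = τ ^ 2 * ⟪xtk1 - xtk, xs - xtk1⟫ := by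
      rw [hx_step, hx_dir, real_inner_smul_left, inner_smul_right]
      ring
    rw [h'] at h
    linarith
  have hη_inner : ⟪η, ys - ytk1⟫ = -(ρk * ⟪s, B (ys - ytk1)⟫)
        - τ * ρk * ‖B‖ ^ 2 * ⟪ytk1 - ytk, ys - ytk1⟫ := by
    have h := congrArg (fun z => ⟪z, ys - ytk1⟫) hη0
    simp only [inner_add_left, real_inner_smul_left, ContinuousLinearMap.adjoint_inner_left,
      inner_zero_left] at h
    linarith
  have hf_step := hξ ((1 - τ) • xk + τ • xs)
  have hf_conv := hf.2 (Set.mem_univ xk) (Set.mem_univ xs) (sub_nonneg.2 hτ1) hτ0.le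
    (sub_add_cancel 1 τ)
  have hg_step := mul_le_mul_of_nonneg_left (hη ys) hτ0.le
  have hg_conv := hgc.2 (Set.mem_univ yk) (Set.mem_univ ytk1) (sub_nonneg.2 hτ1) hτ0.le
    (sub_add_cancel 1 τ)
  rw [← hyk1] at hg_conv
  simp only [smul_eq_mul] at hf_conv hg_conv
  rw [hξ_inner, inner_sub_sub_eq_half_norm_sq] at hf_step
  rw [hη_inner, inner_sub_sub_eq_half_norm_sq, norm_sub_rev ys ytk1] at hg_step
  linarith [mul_le_mul_of_nonneg_left hkey hρk.le, mul_le_mul_of_nonneg_left hdist hρk.le,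
    mul_le_mul_of_nonneg_left hB (by positivity : 0 ≤ ρk * τ ^ 2),
    (by positivity : 0 ≤ γ0 * τ ^ 2 * ‖xtk1 - xtk‖ ^ 2)]
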